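/- arXiv:2303.10525 — 2 statements merged into one kernel-verified Lean document; each statement's English description precedes it below -/
import Mathlib

section
/- Let X be a Polish space, P0 and Pθ Borel probability measures on X, and D : P(X) × P(X) → [0,∞) a function satisfying: D(P, P) = 0 for all P; D(P, Q) = D(Q, P); D(P, Q) ≤ D(P, R) + D(R, Q); D(P, (1−λ)Q + λR) ≤ (1−λ)D(P, Q) + λD(P, R) for all λ ∈ (0,1) (note the paper states the convexity bound with these coefficients); and D(P_n, Q) → D(P, Q) whenever P_n converges weakly to P. Suppose I_{ε0}(θ) < ∞ for some ε0 ≥ 0, where I_ε(θ) = inf { KL(Q|Pθ) : Q ∈ P(X), D(Q, P0) ≤ ε }. Then for every ε > ε0, lim_{n→∞} (1/n) log Pθ^{⊗n}( { z ∈ X^n : D(P̂_{z}, P0) ≤ ε } ) = − I_ε(θ), where P̂_z = n^{−1} Σ_{i=1}^n δ_{z_i} is the empirical measure of z = (z_1, …, z_n). -/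
open MeasureTheory ENNReal Filter Topology
open scoped Classical BigOperators BoundedContinuousFunction

/-- Kullback–Leibler divergence `KL(Q|P) = ∫ log (dQ/dP) dQ` if `Q ≪ P` (and the integral
exists), and `∞` otherwise. -/
noncomputable def KLdiv {X : Type*} [MeasurableSpace X] (Q P : Measure X) : ℝ≥0∞ :=
  if Q ≪ P ∧ Integrable (fun x => Real.log (Q.rnDeriv P x).toReal) Q
  then ENNReal.ofReal (∫ x, Real.log (Q.rnDeriv P x).toReal ∂Q) else ⊤

/-- OKL with respect to a real-valued discrepancy `D`:
`I_r(θ) = inf { KL(Q|Pθ) : Q ∈ P(X), D(Q, P0) ≤ r }`. -/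
noncomputable def OKLD {X : Type*} [MeasurableSpace X]
    (D : Measure X → Measure X → ℝ) (P0 Pθ : Measure X) (r : ℝ) : ℝ≥0∞ :=
  ⨅ Q ∈ {Q : Measure X | IsProbabilityMeasure Q ∧ D Q P0 ≤ r}, KLdiv Q Pθ

/-- Empirical measure of the tuple `z : Fin n → X`. -/
noncomputable def empMeasure {X : Type*} [MeasurableSpace X] {n : ℕ}
    (z : Fin n → X) : Measure X :=
  ((n : ℝ≥0∞))⁻¹ • ∑ i : Fin n, Measure.dirac (z i)

section

open ProbabilityTheory InformationTheory

theorem KLdiv_eq_klDiv {X : Type*} [MeasurableSpace X] (Q P : Measure X)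
    [IsProbabilityMeasure Q] [IsProbabilityMeasure P] : KLdiv Q P = klDiv Q P := by
  rw [KLdiv, klDiv_def]
  simp [llr_def]

theorem klDiv_convexComb_le {X : Type*} [MeasurableSpace X] (Q R P : Measure X)
    [IsProbabilityMeasure Q] [IsProbabilityMeasure R] [IsProbabilityMeasure P]
    {lam : ℝ} (h0 : 0 < lam) (h1 : lam < 1) :
    klDiv (ENNReal.ofReal (1 - lam) • Q + ENNReal.ofReal lam • R) P ≤
      ENNReal.ofReal (1 - lam) * klDiv Q P + ENNReal.ofReal lam * klDiv R P := by
  have hl : ENNReal.ofReal lam ≠ 0 := by simpa using h0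
  have hl' : ENNReal.ofReal (1 - lam) ≠ 0 := by simpa using h1
  by_cases hQ : Q ≪ P
  swap; · simp [klDiv_of_not_ac hQ, hl']
  by_cases hR : R ≪ P
  swap; · simp [klDiv_of_not_ac hR, hl]
  have : IsFiniteMeasure (ENNReal.ofReal (1 - lam) • Q) := Q.smul_finite ENNReal.ofReal_ne_top
  have : IsFiniteMeasure (ENNReal.ofReal lam • R) := R.smul_finite ENNReal.ofReal_ne_top
  have hac : ENNReal.ofReal (1 - lam) • Q + ENNReal.ofReal lam • R ≪ P :=
    (hQ.smul_left _).add_left (hR.smul_left _)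
  rw [klDiv_eq_lintegral_klFun_of_ac hac, klDiv_eq_lintegral_klFun_of_ac hQ,
    klDiv_eq_lintegral_klFun_of_ac hR, ← lintegral_const_mul _ (by fun_prop),
    ← lintegral_const_mul _ (by fun_prop), ← lintegral_add_left (by fun_prop)]
  refine lintegral_mono_ae ?_
  filter_upwards [Measure.rnDeriv_add (ENNReal.ofReal (1 - lam) • Q) (ENNReal.ofReal lam • R) P,
    Measure.rnDeriv_smul_left_of_ne_top Q P (ENNReal.ofReal_ne_top (r := 1 - lam)),
    Measure.rnDeriv_smul_left_of_ne_top R P (ENNReal.ofReal_ne_top (r := lam)),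
    Q.rnDeriv_lt_top P, R.rnDeriv_lt_top P] with x h h' h'' hq hr
  rw [h, Pi.add_apply, h', h'', Pi.smul_apply, Pi.smul_apply,
    ← ENNReal.ofReal_mul (by linarith), ← ENNReal.ofReal_mul (by linarith),
    ← ENNReal.ofReal_add (mul_nonneg (by linarith) (klFun_nonneg ENNReal.toReal_nonneg))
      (mul_nonneg h0.le (klFun_nonneg ENNReal.toReal_nonneg))]
  refine ENNReal.ofReal_le_ofReal ?_
  have hadd : (ENNReal.ofReal (1 - lam) • Q.rnDeriv P x + ENNReal.ofReal lam • R.rnDeriv P x).toReal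
      = (1 - lam) • (Q.rnDeriv P x).toReal + lam • (R.rnDeriv P x).toReal := by
    simp only [smul_eq_mul]
    rw [ENNReal.toReal_add (by finiteness) (by finiteness), ENNReal.toReal_mul, ENNReal.toReal_mul,
      ENNReal.toReal_ofReal (by linarith), ENNReal.toReal_ofReal h0.le]
  rw [hadd]
  exact convexOn_klFun.2 (Set.mem_Ici.2 ENNReal.toReal_nonneg) (Set.mem_Ici.2 ENNReal.toReal_nonneg)
    (by linarith) h0.le (by ring)

theorem isProbabilityMeasure_empMeasure {X : Type*} [MeasurableSpace X] {n : ℕ} (hn : n ≠ 0)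
    (z : Fin n → X) : IsProbabilityMeasure (empMeasure z) := by
  constructor
  simp [empMeasure, ENNReal.inv_mul_cancel, hn]

theorem integral_empMeasure {X : Type*} [MeasurableSpace X] {n : ℕ} (z : Fin n → X)
    {f : X → ℝ} (hf : Measurable f) :
    ∫ x, f x ∂(empMeasure z) = (n : ℝ)⁻¹ * ∑ i, f (z i) := by
  rw [empMeasure, integral_smul_measure, integral_finsetSum_measure]
  · simp [integral_dirac' _ _ hf.stronglyMeasurable]
  · intro i _
    refine (integrable_const (f (z i))).congr ?_
    rw [Filter.EventuallyEq, ae_dirac_iff (measurableSet_eq_fun measurable_const hf)]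

theorem lintegral_empMeasure {X : Type*} [MeasurableSpace X] {n : ℕ} (z : Fin n → X)
    {f : X → ℝ≥0∞} (hf : Measurable f) :
    ∫⁻ x, f x ∂(empMeasure z) = (n : ℝ≥0∞)⁻¹ * ∑ i, f (z i) := by
  rw [empMeasure, lintegral_smul_measure, lintegral_finsetSum_measure]
  simp [lintegral_dirac' _ hf]

/-- The empirical measure as a Markov kernel from `n`-tuples. -/
noncomputable def empKernel (X : Type*) [MeasurableSpace X] (n : ℕ) : Kernel (Fin n → X) X where
  toFun := empMeasure
  measurable' := by
    refine Measure.measurable_of_measurable_coe _ fun s hs => ?_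
    simp_rw [← lintegral_indicator_one hs,
      lintegral_empMeasure _ (measurable_one.indicator hs)]
    have : Measurable (s.indicator (1 : X → ℝ≥0∞)) := measurable_one.indicator hs
    fun_prop

theorem empKernel_apply {X : Type*} [MeasurableSpace X] {n : ℕ} (z : Fin n → X) :
    empKernel X n z = empMeasure z := rfl

theorem isMarkovKernel_empKernel {X : Type*} [MeasurableSpace X] {n : ℕ} (hn : n ≠ 0) :
    IsMarkovKernel (empKernel X n) :=
  ⟨isProbabilityMeasure_empMeasure hn⟩

theorem integral_comp_empKernel {X : Type*} [MeasurableSpace X] {n : ℕ} (hn : n ≠ 0)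
    (ν : Measure (Fin n → X)) [IsProbabilityMeasure ν] {f : X → ℝ} (hf : Measurable f) {C : ℝ}
    (hC : ∀ x, |f x| ≤ C) :
    ∫ x, f x ∂(empKernel X n ∘ₘ ν) = ∫ z, (n : ℝ)⁻¹ * ∑ i, f (z i) ∂ν := by
  have := isMarkovKernel_empKernel (X := X) hn
  rw [Measure.comp_eq_comp_const_apply, Kernel.integral_comp
    (.of_bound hf.aestronglyMeasurable C (.of_forall hC)), Kernel.const_apply]
  simp_rw [empKernel_apply, integral_empMeasure _ hf]

/-- If `Q` has density `q` with respect to `P`, then `Q^{⊗n}` has density `∏ q (z i)` with respect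
to `P^{⊗n}`. -/
theorem pi_withDensity_prod {X : Type*} [MeasurableSpace X] (P : Measure X)
    [IsProbabilityMeasure P] {q : X → ℝ≥0∞} (hq : Measurable q)
    [IsProbabilityMeasure (P.withDensity q)] (n : ℕ) :
    (Measure.pi fun _ : Fin n => P.withDensity q)
      = (Measure.pi fun _ : Fin n => P).withDensity fun z => ∏ i, q (z i) := by
  refine Measure.pi_eq fun s hs => ?_
  rw [withDensity_apply _ (MeasurableSet.univ_pi hs),
    ← lintegral_indicator (MeasurableSet.univ_pi hs)]
  have hind : ∀ z : Fin n → X, (Set.univ.pi s).indicator (fun z => ∏ i, q (z i)) z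
      = ∏ i, (s i).indicator q (z i) := by
    intro z
    by_cases hz : z ∈ Set.univ.pi s
    · rw [Set.indicator_of_mem hz]
      exact Finset.prod_congr rfl fun i _ => (Set.indicator_of_mem (hz i trivial) _).symm
    · rw [Set.indicator_of_notMem hz]
      simp only [Set.mem_univ_pi, not_forall] at hz
      obtain ⟨i, hi⟩ := hz
      exact (Finset.prod_eq_zero (Finset.mem_univ i) (Set.indicator_of_notMem hi _)).symm
  simp_rw [hind]
  rw [lintegral_prod_eq_prod_lintegral_of_indepFun Finset.univ
    (fun i (z : Fin n → X) => (s i).indicator q (z i))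
    (iIndepFun_pi fun i => (hq.indicator (hs i)).aemeasurable)
    (fun i => (hq.indicator (hs i)).comp (measurable_pi_apply i))]
  refine Finset.prod_congr rfl fun i _ => ?_
  rw [(measurePreserving_eval (fun _ : Fin n => P) i).lintegral_comp (hq.indicator (hs i)),
    lintegral_indicator (hs i), withDensity_apply _ (hs i)]

/-- Weak convergence of a sequence of measures, tested on bounded continuous functions. -/
def TendstoWeakly {X : Type*} [MeasurableSpace X] [TopologicalSpace X]
    (Ps : ℕ → Measure X) (P : Measure X) : Prop :=
  ∀ f : X →ᵇ ℝ, Tendsto (fun n => ∫ x, f x ∂(Ps n)) atTop (𝓝 (∫ x, f x ∂P))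

theorem tendstoWeakly_empMeasure {X : Type*} [MeasurableSpace X] [TopologicalSpace X]
    [OpensMeasurableSpace X] {n : ℕ} {z : ℕ → Fin n → X} {y : Fin n → X}
    (h : Tendsto z atTop (𝓝 y)) :
    TendstoWeakly (fun m => empMeasure (z m)) (empMeasure y) := by
  intro f
  simp_rw [integral_empMeasure _ f.continuous.measurable]
  exact (tendsto_finsetSum _ fun i _ =>
    (f.continuous.tendsto _).comp (tendsto_pi_nhds.1 h i)).const_mul _

/-- A finite mixture of elements of a convex set of probability measures, if it is a probability
measure, belongs to the set. -/
theorem sum_smul_mem_of_convex {X : Type*} [MeasurableSpace X] {C : Set (Measure X)}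
    (hprob : ∀ Q ∈ C, IsProbabilityMeasure Q)
    (hconv : ∀ Q ∈ C, ∀ R ∈ C, ∀ lam : ℝ, 0 < lam → lam < 1 →
      ENNReal.ofReal (1 - lam) • Q + ENNReal.ofReal lam • R ∈ C)
    {ι : Type*} (s : Finset ι) (w : ι → ℝ≥0∞) (hw : ∀ i ∈ s, w i ≠ ∞) (Q : ι → Measure X)
    (hQ : ∀ i ∈ s, Q i ∈ C) (h : IsProbabilityMeasure (∑ i ∈ s, w i • Q i)) :
    ∑ i ∈ s, w i • Q i ∈ C := by
  have hcone : ∃ c : ℝ, 0 ≤ c ∧ ∃ R ∈ C, ∑ i ∈ s, w i • Q i = ENNReal.ofReal c • R := by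
    have hs : s.Nonempty := by
      rw [Finset.nonempty_iff_ne_empty]
      rintro rfl
      simpa using h.measure_univ
    obtain ⟨i₀, hi₀⟩ := hs
    refine Finset.sum_induction (fun i => w i • Q i)
      (fun μ => ∃ c : ℝ, 0 ≤ c ∧ ∃ R ∈ C, μ = ENNReal.ofReal c • R) ?_
      ⟨0, le_rfl, Q i₀, hQ i₀ hi₀, by simp⟩
      fun i hi => ⟨(w i).toReal, ENNReal.toReal_nonneg, Q i, hQ i hi, by
        rw [ENNReal.ofReal_toReal (hw i hi)]⟩
    rintro _ _ ⟨c, hc, R, hR, rfl⟩ ⟨d, hd, S, hS, rfl⟩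
    rcases hc.eq_or_lt with rfl | hc'
    · exact ⟨d, hd, S, hS, by simp⟩
    rcases hd.eq_or_lt with rfl | hd'
    · exact ⟨c, hc, R, hR, by simp⟩
    refine ⟨c + d, by positivity, _, hconv R hR S hS (d / (c + d)) (by positivity)
      ((div_lt_one (by positivity)).2 (by linarith)), ?_⟩
    rw [smul_add, smul_smul, smul_smul, ← ENNReal.ofReal_mul (by positivity),
      ← ENNReal.ofReal_mul (by positivity)]
    congr 3 <;> field_simp
    ring
  obtain ⟨c, hc, R, hR, hsum⟩ := hcone
  have := hprob R hR
  have h1 := h.measure_univ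
  rw [hsum, Measure.smul_apply, measure_univ, smul_eq_mul, mul_one] at h1
  rw [hsum, h1, one_smul]
  exact hR

/-- Jensen's inequality for sets: the barycenter of the empirical measures under a law carried by
`{z | empMeasure z ∈ C}` belongs to `C` when `C` is convex and weakly closed. -/
theorem comp_empKernel_mem {X : Type*} [MeasurableSpace X] [TopologicalSpace X] [PolishSpace X]
    [BorelSpace X] {C : Set (Measure X)} (hprob : ∀ Q ∈ C, IsProbabilityMeasure Q)
    (hconv : ∀ Q ∈ C, ∀ R ∈ C, ∀ lam : ℝ, 0 < lam → lam < 1 →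
      ENNReal.ofReal (1 - lam) • Q + ENNReal.ofReal lam • R ∈ C)
    (hclosed : ∀ (Qs : ℕ → Measure X) (Q : Measure X), (∀ n, Qs n ∈ C) → IsProbabilityMeasure Q →
      TendstoWeakly Qs Q → Q ∈ C)
    {n : ℕ} (hn : n ≠ 0) (ν : Measure (Fin n → X)) [IsProbabilityMeasure ν]
    (hν : ∀ᵐ z ∂ν, empMeasure z ∈ C) : empKernel X n ∘ₘ ν ∈ C := by
  let := TopologicalSpace.upgradeIsCompletelyMetrizable X
  have := isMarkovKernel_empKernel (X := X) hn
  obtain ⟨z₀, hz₀⟩ := hν.exists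
  let A : Set (Fin n → X) := {z | empMeasure z ∈ C}
  have hz₀ : z₀ ∈ A := hz₀
  let φ (m : ℕ) : SimpleFunc (Fin n → X) (Fin n → X) :=
    SimpleFunc.approxOn id measurable_id A z₀ hz₀ m
  have hφA (m z) : empMeasure (φ m z) ∈ C := SimpleFunc.approxOn_mem measurable_id hz₀ m z
  have hφm (m) : IsProbabilityMeasure (ν.map (φ m)) :=
    Measure.isProbabilityMeasure_map (φ m).measurable.aemeasurable
  refine hclosed (fun m => empKernel X n ∘ₘ (ν.map (φ m))) _ (fun m => ?_) inferInstance
    fun f => ?_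
  · have hsum : empKernel X n ∘ₘ (ν.map (φ m))
        = ∑ y ∈ (φ m).range, ν (φ m ⁻¹' {y}) • empMeasure y := by
      ext s hs
      rw [Measure.bind_apply hs (Kernel.aemeasurable _),
        lintegral_map ((empKernel X n).measurable_coe hs) (φ m).measurable]
      have := SimpleFunc.lintegral_eq_lintegral ((φ m).map fun y => empKernel X n y s) ν
      rw [SimpleFunc.map_lintegral] at this
      simpa [empKernel_apply, mul_comm] using this
    have hp : IsProbabilityMeasure (empKernel X n ∘ₘ (ν.map (φ m))) := inferInstance
    rw [hsum] at hp ⊢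
    refine sum_smul_mem_of_convex hprob hconv _ _ (fun _ _ => measure_ne_top _ _) _
      (fun y hy => ?_) hp
    obtain ⟨z, rfl⟩ := SimpleFunc.mem_range.1 hy
    exact hφA m z
  · have hb (x : X) : |f x| ≤ ‖f‖ := f.norm_coe_le_norm x
    have hcont : Continuous fun z : Fin n → X => (n : ℝ)⁻¹ * ∑ i, f (z i) := by fun_prop
    simp_rw [fun m => integral_comp_empKernel hn (ν.map (φ m)) f.continuous.measurable hb,
      integral_comp_empKernel hn ν f.continuous.measurable hb]
    simp_rw [fun m => integral_map (μ := ν) (φ m).measurable.aemeasurable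
      hcont.aestronglyMeasurable]
    refine tendsto_integral_of_dominated_convergence (fun _ => (n : ℝ)⁻¹ * ∑ _i : Fin n, ‖f‖)
      (fun m => (hcont.measurable.comp (φ m).measurable).aestronglyMeasurable)
      (integrable_const _) (fun m => .of_forall fun z => ?_) ?_
    · rw [norm_mul, norm_inv, Real.norm_natCast]
      gcongr
      exact (norm_sum_le _ _).trans (Finset.sum_le_sum fun i _ => f.norm_coe_le_norm _)
    · filter_upwards [hν] with z hz
      exact (hcont.tendsto z).comp
        (SimpleFunc.tendsto_approxOn measurable_id hz₀ (subset_closure (s := A) hz))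

/-- A second-countable space carries a countable π-system of open sets which is a basis. -/
theorem exists_countable_isPiSystem_basis (X : Type*) [TopologicalSpace X]
    [SecondCountableTopology X] :
    ∃ S : Set (Set X), S.Countable ∧ IsPiSystem S ∧ TopologicalSpace.IsTopologicalBasis S := by
  obtain ⟨b, hbc, -, hb⟩ := TopologicalSpace.exists_countable_basis X
  refine ⟨(fun f => ⋂₀ f) '' {f : Set (Set X) | f.Finite ∧ f ⊆ b},
    (Set.countable_ofPred_finite_subset hbc).image _, ?_,
    TopologicalSpace.isTopologicalBasis_of_subbasis hb.eq_generateFrom⟩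
  rintro _ ⟨f, ⟨hf, hfb⟩, rfl⟩ _ ⟨g, ⟨hg, hgb⟩, rfl⟩ -
  exact ⟨f ∪ g, ⟨hf.union hg, Set.union_subset hfb hgb⟩, Set.sInter_union f g⟩

/-- Strong law of large numbers for i.i.d. coordinates, written on `Fin n`-indexed prefixes. -/
theorem ae_tendsto_average_infinitePi {X : Type*} [MeasurableSpace X] (Q : Measure X)
    [IsProbabilityMeasure Q] {g : X → ℝ} (hg : Measurable g) (hint : Integrable g Q) :
    ∀ᵐ ω ∂(Measure.infinitePi fun _ : ℕ => Q),
      Tendsto (fun n : ℕ => (n : ℝ)⁻¹ * ∑ i : Fin n, g (ω i)) atTop (𝓝 (∫ x, g x ∂Q)) := by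
  have hmp (i : ℕ) := measurePreserving_eval_infinitePi (fun _ : ℕ => Q) i
  have hind : iIndepFun (fun (i : ℕ) (ω : ℕ → X) => g (ω i)) (Measure.infinitePi fun _ => Q) :=
    iIndepFun_infinitePi fun _ => hg
  have hlaw := strong_law_ae_real (μ := Measure.infinitePi fun _ : ℕ => Q)
    (fun i ω => g (ω i)) ((hmp 0).integrable_comp_of_integrable hint)
    (fun i j hij => hind.indepFun hij) fun i =>
      IdentDistrib.comp (u := g) ⟨(measurable_pi_apply i).aemeasurable,
        (measurable_pi_apply 0).aemeasurable, (hmp i).map_eq.trans (hmp 0).map_eq.symm⟩ hg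
  have hE : ∫ ω, g (ω 0) ∂(Measure.infinitePi fun _ : ℕ => Q) = ∫ x, g x ∂Q := by
    conv_rhs => rw [← (hmp 0).map_eq]
    rw [integral_map (measurable_pi_apply 0).aemeasurable hg.aestronglyMeasurable]
  filter_upwards [hlaw] with ω hω
  rw [hE] at hω
  refine hω.congr fun n => ?_
  rw [div_eq_inv_mul, ← Fin.sum_univ_eq_sum_range fun i => g (ω i)]

/-- **Varadarajan's theorem**: empirical measures of an i.i.d. sample converge weakly almost
surely. -/
theorem ae_tendstoWeakly_empMeasure {X : Type*} [MeasurableSpace X] [TopologicalSpace X]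
    [SecondCountableTopology X] [HasOuterApproxClosed X] [BorelSpace X]
    (Q : Measure X) [IsProbabilityMeasure Q] :
    ∀ᵐ ω ∂(Measure.infinitePi fun _ : ℕ => Q),
      TendstoWeakly (fun n => empMeasure fun i : Fin (n + 1) => ω i) Q := by
  obtain ⟨S, hSc, hSpi, hSb⟩ := exists_countable_isPiSystem_basis X
  have hS (s) (hs : s ∈ S) : MeasurableSet s := (hSb.isOpen hs).measurableSet
  have hall : ∀ᵐ ω ∂(Measure.infinitePi fun _ : ℕ => Q), ∀ s ∈ S,
      Tendsto (fun n : ℕ => (n : ℝ)⁻¹ * ∑ i : Fin n, s.indicator (1 : X → ℝ) (ω i)) atTop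
        (𝓝 (∫ x, s.indicator (1 : X → ℝ) x ∂Q)) :=
    (ae_ball_iff hSc).2 fun s hs => ae_tendsto_average_infinitePi Q
      (measurable_one.indicator (hS s hs)) ((integrable_const 1).indicator (hS s hs))
  filter_upwards [hall] with ω hω
  let μ (n : ℕ) : ProbabilityMeasure X :=
    ⟨empMeasure fun i : Fin (n + 1) => ω i, isProbabilityMeasure_empMeasure n.succ_ne_zero _⟩
  have hμ : Tendsto μ atTop (𝓝 ⟨Q, inferInstance⟩) := by
    refine hSpi.tendsto_probabilityMeasure_of_tendsto_of_mem hS (fun u hu x hx => ?_) fun s hs => ?_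
    · obtain ⟨s, hs, hxs, hsu⟩ := hSb.exists_subset_of_mem_open hx hu
      exact ⟨s, hs, (hSb.isOpen hs).mem_nhds hxs, hsu⟩
    · rw [← NNReal.tendsto_coe]
      have := (tendsto_add_atTop_iff_nat 1).2 (hω s hs)
      rw [integral_indicator_one (hS s hs)] at this
      refine this.congr fun n => ?_
      rw [← integral_empMeasure (fun i : Fin (n + 1) => ω i) (measurable_one.indicator (hS s hs)),
        integral_indicator_one (hS s hs)]
      rfl
  exact ProbabilityMeasure.tendsto_iff_forall_integral_tendsto.1 hμ

/-- The variational (Donsker–Varadhan) bound controls the Kullback–Leibler divergence of a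
probability measure with bounded density. -/
theorem klDiv_le_of_forall_integral_le {X : Type*} [MeasurableSpace X] {Q P : Measure X}
    [IsProbabilityMeasure Q] [IsProbabilityMeasure P] {K : ℝ≥0∞} (hK : K ≠ ∞) (hQP : Q ≤ K • P)
    {c : ℝ} (h : ∀ g : X → ℝ, Measurable g → (∃ B, ∀ x, |g x| ≤ B) →
      ∫ x, g x ∂Q ≤ c + Real.log (∫ x, Real.exp (g x) ∂P)) :
    klDiv Q P ≤ ENNReal.ofReal c := by
  have hac : Q ≪ P := Measure.absolutelyContinuous_of_le_smul hQP
  let q (x : X) : ℝ := (Q.rnDeriv P x).toReal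
  have hqm : Measurable q := (Q.measurable_rnDeriv P).ennreal_toReal
  have hq0 (x : X) : 0 ≤ q x := ENNReal.toReal_nonneg
  have hqK : ∀ᵐ x ∂P, q x ≤ K.toReal := by
    have : Q.rnDeriv P ≤ᵐ[P] fun _ => K := by
      refine ae_le_of_forall_setLIntegral_le_of_sigmaFinite (Q.measurable_rnDeriv P)
        fun s hs _ => ?_
      rw [Measure.setLIntegral_rnDeriv hac, setLIntegral_const]
      exact hQP s
    filter_upwards [this] with x hx
    exact ENNReal.toReal_mono hK hx
  have hqint : Integrable q P := Measure.integrable_toReal_rnDeriv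
  have hint : Integrable (llr Q P) Q := by
    obtain ⟨M, hM⟩ := (isCompact_Icc (a := (0 : ℝ)) (b := K.toReal)).exists_bound_of_continuousOn
      continuous_klFun.continuousOn
    rw [← integrable_klFun_rnDeriv_iff hac]
    refine .of_bound (measurable_klFun.comp hqm).aestronglyMeasurable M ?_
    filter_upwards [hqK] with x hx
    exact hM _ ⟨hq0 x, hx⟩
  rw [klDiv_of_ac_of_integrable hac hint]
  refine ENNReal.ofReal_le_ofReal ?_
  simp only [probReal_univ, add_sub_cancel_right]
  refine le_of_forall_pos_le_add fun δ hδ => ?_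
  have hpos (x : X) : 0 < min (q x) K.toReal + δ :=
    add_pos_of_nonneg_of_pos (le_min (hq0 x) ENNReal.toReal_nonneg) hδ
  have hgm : Measurable fun x => Real.log (min (q x) K.toReal + δ) := by fun_prop
  have hgb : ∃ B, ∀ x, |Real.log (min (q x) K.toReal + δ)| ≤ B :=
    ⟨max |Real.log δ| |Real.log (K.toReal + δ)|, fun x => abs_le_max_abs_abs
      (Real.log_le_log hδ (by linarith [le_min (hq0 x) (ENNReal.toReal_nonneg (a := K))]))
      (Real.log_le_log (hpos x) (by linarith [min_le_right (q x) K.toReal]))⟩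
  have hmint : Integrable (fun x => min (q x) K.toReal) P := hqint.inf (integrable_const _)
  calc ∫ x, llr Q P x ∂Q
      ≤ ∫ x, Real.log (min (q x) K.toReal + δ) ∂Q := by
        obtain ⟨B, hB⟩ := hgb
        refine integral_mono_ae hint (.of_bound hgm.aestronglyMeasurable B (.of_forall hB)) ?_
        filter_upwards [Measure.rnDeriv_pos hac, hac.ae_le (Q.rnDeriv_lt_top P), hac.ae_le hqK]
          with x h1 h2 h3
        refine Real.log_le_log (ENNReal.toReal_pos h1.ne' h2.ne) ?_
        rw [min_eq_left h3]
        exact le_add_of_nonneg_right hδ.le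
    _ ≤ c + Real.log (∫ x, Real.exp (Real.log (min (q x) K.toReal + δ)) ∂P) := h _ hgm hgb
    _ = c + Real.log (∫ x, min (q x) K.toReal ∂P + δ) := by
        simp_rw [fun x => Real.exp_log (hpos x)]
        rw [integral_add hmint (integrable_const _)]
        simp
    _ ≤ c + Real.log (1 + δ) := by
        gcongr
        calc ∫ x, min (q x) K.toReal ∂P ≤ ∫ x, q x ∂P :=
              integral_mono hmint hqint fun x => min_le_left _ _
          _ = 1 := by rw [Measure.integral_toReal_rnDeriv hac, probReal_univ]
    _ ≤ c + δ := by
        gcongr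
        linarith [Real.log_le_sub_one_of_pos (show 0 < 1 + δ by linarith)]

/-- Non-asymptotic Sanov upper bound for a weakly closed convex set `C`: some element of `C` has
divergence at most `-(1/n) log P^{⊗n}(empMeasure ∈ C)`. -/
theorem exists_mem_klDiv_le {X : Type*} [MeasurableSpace X] [TopologicalSpace X] [PolishSpace X]
    [BorelSpace X] {C : Set (Measure X)} (hprob : ∀ Q ∈ C, IsProbabilityMeasure Q)
    (hconv : ∀ Q ∈ C, ∀ R ∈ C, ∀ lam : ℝ, 0 < lam → lam < 1 →
      ENNReal.ofReal (1 - lam) • Q + ENNReal.ofReal lam • R ∈ C)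
    (hclosed : ∀ (Qs : ℕ → Measure X) (Q : Measure X), (∀ n, Qs n ∈ C) → IsProbabilityMeasure Q →
      TendstoWeakly Qs Q → Q ∈ C)
    {n : ℕ} (hn : n ≠ 0) (P : Measure X) [IsProbabilityMeasure P]
    (hmeas : MeasurableSet {z : Fin n → X | empMeasure z ∈ C})
    (hpos : 0 < (Measure.pi fun _ : Fin n => P).real {z | empMeasure z ∈ C}) :
    ∃ Q ∈ C, klDiv Q P ≤ ENNReal.ofReal
      (-(1 / (n : ℝ) * Real.log ((Measure.pi fun _ : Fin n => P).real {z | empMeasure z ∈ C}))) := by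
  set Pn := Measure.pi fun _ : Fin n => P with hPn
  set A := {z : Fin n → X | empMeasure z ∈ C}
  have hA : Pn A ≠ 0 := fun h => by simp [Measure.real, h] at hpos
  let ν := Pn[|A]
  have hν : IsProbabilityMeasure ν := cond_isProbabilityMeasure hA
  have hνle : ν ≤ (Pn A)⁻¹ • Pn := by
    intro s
    change (Pn A)⁻¹ * Pn.restrict A s ≤ (Pn A)⁻¹ * Pn s
    gcongr
    exact Measure.restrict_le_self
  have := isMarkovKernel_empKernel (X := X) hn
  have hmemC : empKernel X n ∘ₘ ν ∈ C :=
    comp_empKernel_mem hprob hconv hclosed hn ν (ae_cond_mem hmeas)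
  have hn' : (0 : ℝ) < n := by positivity
  refine ⟨_, hmemC, klDiv_le_of_forall_integral_le (ENNReal.inv_ne_top.2 hA) ?_ ?_⟩
  · refine Measure.le_iff.2 fun s hs => ?_
    have hsi : Measurable (s.indicator (1 : X → ℝ≥0∞)) := measurable_one.indicator hs
    have hmean : ∫⁻ z, empKernel X n z s ∂Pn = P s := by
      have heval (i : Fin n) : ∫⁻ z, s.indicator (1 : X → ℝ≥0∞) (z i) ∂Pn = P s :=
        ((measurePreserving_eval (fun _ : Fin n => P) i).lintegral_comp hsi).trans
          (lintegral_indicator_one hs)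
      simp_rw [empKernel_apply, ← fun z : Fin n → X => lintegral_indicator_one
        (μ := empMeasure z) hs, lintegral_empMeasure _ hsi]
      rw [lintegral_const_mul _ (by fun_prop), lintegral_finsetSum _ (by fun_prop)]
      simp [heval, ← mul_assoc, ENNReal.inv_mul_cancel, hn]
    rw [Measure.bind_apply hs (Kernel.aemeasurable _)]
    calc ∫⁻ z, empKernel X n z s ∂ν ≤ ∫⁻ z, empKernel X n z s ∂((Pn A)⁻¹ • Pn) :=
          lintegral_mono' hνle le_rfl
      _ = ((Pn A)⁻¹ • P) s := by rw [lintegral_smul_measure, hmean]; rfl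
  · rintro g hg ⟨B, hB⟩
    have hGm : Measurable fun z : Fin n → X => ∑ i, g (z i) := by fun_prop
    have hGb (z : Fin n → X) : |∑ i, g (z i)| ≤ n * B := by
      refine (Finset.abs_sum_le_sum_abs _ _).trans
        ((Finset.sum_le_sum fun i _ => hB (z i)).trans_eq ?_)
      simp
    have hint (μ : Measure (Fin n → X)) [IsProbabilityMeasure μ] :
        Integrable (fun z => ∑ i, g (z i)) μ :=
      .of_bound hGm.aestronglyMeasurable _ (.of_forall hGb)
    have hexpint (μ : Measure (Fin n → X)) [IsProbabilityMeasure μ] :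
        Integrable (fun z => Real.exp (∑ i, g (z i))) μ :=
      .of_bound hGm.exp.aestronglyMeasurable (Real.exp (n * B)) (.of_forall fun z => by
        rw [Real.norm_eq_abs, Real.abs_exp]
        exact Real.exp_le_exp.2 ((le_abs_self _).trans (hGb z)))
    have hM : 0 < ∫ x, Real.exp (g x) ∂P :=
      integral_exp_pos (.of_bound hg.exp.aestronglyMeasurable (Real.exp B) (.of_forall fun x => by
        rw [Real.norm_eq_abs, Real.abs_exp]
        exact Real.exp_le_exp.2 ((le_abs_self _).trans (hB x))))
    have hjensen : Real.exp (∫ z, ∑ i, g (z i) ∂ν) ≤ ∫ z, Real.exp (∑ i, g (z i)) ∂ν :=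
      convexOn_exp.map_integral_le Real.continuous_exp.continuousOn isClosed_univ
        (.of_forall fun _ => trivial) (hint ν) (hexpint ν)
    have hcond : ∫ z, Real.exp (∑ i, g (z i)) ∂ν
        ≤ (Pn.real A)⁻¹ * (∫ x, Real.exp (g x) ∂P) ^ n := by
      have hprod : ∫ z, Real.exp (∑ i, g (z i)) ∂Pn = (∫ x, Real.exp (g x) ∂P) ^ n := by
        simp_rw [Real.exp_sum]
        rw [hPn, integral_fintype_prod_eq_pow (fun x => Real.exp (g x)), Fintype.card_fin]
      rw [← hprod]
      simp only [ν, ProbabilityTheory.cond]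
      rw [integral_smul_measure, ENNReal.toReal_inv, smul_eq_mul]
      exact mul_le_mul_of_nonneg_left
        (setIntegral_le_integral (hexpint Pn) (.of_forall fun z => (Real.exp_pos _).le))
        (by positivity)
    have hlog : ∫ z, ∑ i, g (z i) ∂ν
        ≤ -Real.log (Pn.real A) + n * Real.log (∫ x, Real.exp (g x) ∂P) := by
      rw [← Real.log_pow, ← Real.log_inv, ← Real.log_mul (by positivity) (by positivity),
        Real.le_log_iff_exp_le (by positivity)]
      exact hjensen.trans hcond
    rw [integral_comp_empKernel hn ν hg hB, integral_const_mul]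
    calc (n : ℝ)⁻¹ * ∫ z, ∑ i, g (z i) ∂ν
        ≤ (n : ℝ)⁻¹ * (-Real.log (Pn.real A) + n * Real.log (∫ x, Real.exp (g x) ∂P)) := by gcongr
      _ = _ := by field_simp

theorem map_prefix_infinitePi {X : Type*} [MeasurableSpace X] (Q : Measure X)
    [IsProbabilityMeasure Q] (n : ℕ) :
    (Measure.infinitePi fun _ : ℕ => Q).map (fun ω (i : Fin n) => ω i)
      = Measure.pi fun _ : Fin n => Q := by
  have hind : iIndepFun (fun (i : ℕ) (ω : ℕ → X) => ω i) (Measure.infinitePi fun _ => Q) :=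
    iIndepFun_infinitePi fun _ => measurable_id
  have h := (iIndepFun_iff_map_fun_eq_pi_map
    fun i : Fin n => (measurable_pi_apply (i : ℕ)).aemeasurable).1
    (hind.precomp (g := fun i : Fin n => (i : ℕ)) Fin.val_injective)
  refine h.trans ?_
  congr 1
  exact funext fun i => (measurePreserving_eval_infinitePi (fun _ : ℕ => Q) i).map_eq

/-- Sanov lower bound by change of measure, for a set `C` that is a sequential weak neighbourhood
of `Q`. -/
theorem eventually_exp_le_measure_empMeasure_mem {X : Type*} [MeasurableSpace X]
    [TopologicalSpace X] [SecondCountableTopology X] [HasOuterApproxClosed X] [BorelSpace X]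
    {C : Set (Measure X)} {Q P : Measure X} [IsProbabilityMeasure Q] [IsProbabilityMeasure P]
    (hac : Q ≪ P) (hint : Integrable (llr Q P) Q)
    (hC : ∀ Ps : ℕ → Measure X, (∀ n, IsProbabilityMeasure (Ps n)) → TendstoWeakly Ps Q →
      ∀ᶠ n in atTop, Ps n ∈ C)
    (hmeas : ∀ n ≠ 0, MeasurableSet {z : Fin n → X | empMeasure z ∈ C}) {δ : ℝ} (hδ : 0 < δ) :
    ∀ᶠ n : ℕ in atTop, Real.exp (-(n * (∫ x, llr Q P x ∂Q + δ))) / 2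
      ≤ (Measure.pi fun _ : Fin n => P).real {z | empMeasure z ∈ C} := by
  rw [← map_add_atTop_eq_nat 1, eventually_map]
  set κ := ∫ x, llr Q P x ∂Q + δ with hκ
  let B (n : ℕ) : Set (Fin n → X) :=
    {z | empMeasure z ∈ C} ∩ {z | (n : ℝ)⁻¹ * ∑ i, llr Q P (z i) < κ}
  have hllr := measurable_llr Q P
  have hBm (n : ℕ) (hn : n ≠ 0) : MeasurableSet (B n) :=
    (hmeas n hn).inter (measurableSet_lt (by fun_prop) measurable_const)
  have hpre (n : ℕ) : Measurable fun (ω : ℕ → X) (i : Fin n) => ω i := by fun_prop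
  have hlim : Tendsto (fun n : ℕ => (Measure.pi fun _ : Fin (n + 1) => Q) (B (n + 1))) atTop
      (𝓝 1) := by
    have := tendsto_measure_of_ae_tendsto_indicator_of_isFiniteMeasure (L := atTop)
      (μ := Measure.infinitePi fun _ : ℕ => Q) (A := Set.univ)
      (As := fun n : ℕ => (fun (ω : ℕ → X) (i : Fin (n + 1)) => ω i) ⁻¹' B (n + 1)) .univ
      (fun n => hpre _ (hBm _ n.succ_ne_zero)) ?_
    · rw [measure_univ] at this
      refine this.congr fun n => ?_
      rw [← Measure.map_apply (hpre _) (hBm _ n.succ_ne_zero), map_prefix_infinitePi]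
    · filter_upwards [ae_tendstoWeakly_empMeasure Q, ae_tendsto_average_infinitePi Q hllr hint]
        with ω h1 h2
      filter_upwards [hC _ (fun n => isProbabilityMeasure_empMeasure n.succ_ne_zero _) h1,
        ((tendsto_add_atTop_iff_nat 1).2 h2).eventually_lt_const (lt_add_of_pos_right _ hδ)]
        with n h3 h4
      exact iff_of_true ⟨h3, h4⟩ trivial
  let q (x : X) : ℝ≥0∞ := ENNReal.ofReal (Q.rnDeriv P x).toReal
  have hqm : Measurable q := (Q.measurable_rnDeriv P).ennreal_toReal.ennreal_ofReal
  have hQ : P.withDensity q = Q := by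
    conv_rhs => rw [← Measure.withDensity_rnDeriv_eq Q P hac]
    refine withDensity_congr_ae ?_
    filter_upwards [Q.rnDeriv_lt_top P] with x hx
    exact ENNReal.ofReal_toReal hx.ne
  have : IsProbabilityMeasure (P.withDensity q) := hQ.symm ▸ inferInstance
  filter_upwards [hlim.eventually_const_lt (u := 2⁻¹) (by simp)] with m hm
  generalize hn : m + 1 = n at hm ⊢
  have hn0 : (0 : ℝ) < n := by rw [← hn]; positivity
  have hle : (Measure.pi fun _ : Fin n => Q) (B n)
      ≤ ENNReal.ofReal (Real.exp (n * κ)) *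
        (Measure.pi fun _ : Fin n => P) {z | empMeasure z ∈ C} := by
    have hpi := pi_withDensity_prod P hqm n
    rw [hQ] at hpi
    rw [hpi, withDensity_apply _ (hBm n (by omega))]
    calc ∫⁻ z in B n, ∏ i, q (z i) ∂(Measure.pi fun _ => P)
        ≤ ∫⁻ _ in B n, ENNReal.ofReal (Real.exp (n * κ)) ∂(Measure.pi fun _ => P) := by
          refine setLIntegral_mono measurable_const fun z hz => ?_
          rw [← ENNReal.ofReal_prod_of_nonneg fun i _ => ENNReal.toReal_nonneg]
          refine ENNReal.ofReal_le_ofReal ?_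
          calc ∏ i, (Q.rnDeriv P (z i)).toReal ≤ ∏ i, Real.exp (llr Q P (z i)) :=
                Finset.prod_le_prod (fun i _ => ENNReal.toReal_nonneg)
                  fun i _ => Real.le_exp_log _
            _ = Real.exp (∑ i, llr Q P (z i)) := (Real.exp_sum _ _).symm
            _ ≤ Real.exp (n * κ) := Real.exp_le_exp.2 ((inv_mul_lt_iff₀ hn0).1 hz.2).le
      _ = ENNReal.ofReal (Real.exp (n * κ)) * (Measure.pi fun _ => P) (B n) :=
          setLIntegral_const _ _
      _ ≤ _ := by gcongr; exact Set.inter_subset_left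
  have hreal := ENNReal.toReal_mono (by finiteness) (hm.le.trans hle)
  rw [ENNReal.toReal_mul, ENNReal.toReal_ofReal (Real.exp_pos _).le] at hreal
  rw [Real.exp_neg, div_eq_mul_inv, inv_mul_le_iff₀ (Real.exp_pos _)]
  simpa [Measure.real] using hreal

theorem measurableSet_empMeasure_mem {X : Type*} [MeasurableSpace X] [TopologicalSpace X]
    [PolishSpace X] [BorelSpace X] {C : Set (Measure X)}
    (hclosed : ∀ (Qs : ℕ → Measure X) (Q : Measure X), (∀ n, Qs n ∈ C) → IsProbabilityMeasure Q →
      TendstoWeakly Qs Q → Q ∈ C) {n : ℕ} (hn : n ≠ 0) :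
    MeasurableSet {z : Fin n → X | empMeasure z ∈ C} :=
  IsClosed.measurableSet <| IsSeqClosed.isClosed fun _ y hz hy =>
    hclosed _ _ hz (isProbabilityMeasure_empMeasure hn y) (tendstoWeakly_empMeasure hy)

theorem isProbabilityMeasure_convexComb {X : Type*} [MeasurableSpace X] (Q R : Measure X)
    [IsProbabilityMeasure Q] [IsProbabilityMeasure R] {lam : ℝ} (h0 : 0 < lam) (h1 : lam < 1) :
    IsProbabilityMeasure (ENNReal.ofReal (1 - lam) • Q + ENNReal.ofReal lam • R) := by
  constructor
  simp only [Measure.add_apply, Measure.smul_apply, measure_univ, smul_eq_mul, mul_one]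
  rw [← ENNReal.ofReal_add (by linarith) h0.le]
  simp

/-- Sanov's theorem for a convex, weakly sequentially closed set `C` in which measures of nearly
minimal divergence can be chosen in the sequential weak interior. -/
theorem tendsto_log_measure_empMeasure_mem {X : Type*} [MeasurableSpace X] [TopologicalSpace X]
    [PolishSpace X] [BorelSpace X] {C : Set (Measure X)} (hprob : ∀ Q ∈ C, IsProbabilityMeasure Q)
    (hconv : ∀ Q ∈ C, ∀ R ∈ C, ∀ lam : ℝ, 0 < lam → lam < 1 →
      ENNReal.ofReal (1 - lam) • Q + ENNReal.ofReal lam • R ∈ C)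
    (hclosed : ∀ (Qs : ℕ → Measure X) (Q : Measure X), (∀ n, Qs n ∈ C) → IsProbabilityMeasure Q →
      TendstoWeakly Qs Q → Q ∈ C)
    (P : Measure X) [IsProbabilityMeasure P] {I : ℝ} (hI : 0 ≤ I)
    (hle : ∀ Q ∈ C, ENNReal.ofReal I ≤ klDiv Q P)
    (hint : ∀ η > 0, ∃ Q : Measure X, IsProbabilityMeasure Q ∧ klDiv Q P ≤ ENNReal.ofReal (I + η) ∧
      ∀ Ps : ℕ → Measure X, (∀ n, IsProbabilityMeasure (Ps n)) → TendstoWeakly Ps Q →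
        ∀ᶠ n in atTop, Ps n ∈ C) :
    Tendsto (fun n : ℕ => 1 / (n : ℝ) *
      Real.log ((Measure.pi fun _ : Fin n => P).real {z | empMeasure z ∈ C})) atTop (𝓝 (-I)) := by
  refine Metric.tendsto_nhds.2 fun η hη => ?_
  obtain ⟨Q, hQ, hQI, hQC⟩ := hint (η / 4) (by positivity)
  obtain ⟨hac, hllr⟩ := klDiv_ne_top_iff.1 (hQI.trans_lt ENNReal.ofReal_lt_top).ne
  have hκ : ∫ x, llr Q P x ∂Q ≤ I + η / 4 := by
    rw [klDiv_of_ac_of_integrable hac hllr, ENNReal.ofReal_le_ofReal_iff (by positivity)] at hQI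
    simpa using hQI
  have hmeas (n : ℕ) (hn : n ≠ 0) := measurableSet_empMeasure_mem hclosed hn
  have hlog2 : Tendsto (fun n : ℕ => Real.log 2 / (n : ℝ)) atTop (𝓝 0) :=
    tendsto_const_div_atTop_nhds_zero_nat _
  filter_upwards [eventually_exp_le_measure_empMeasure_mem hac hllr hQC hmeas
    (show 0 < η / 4 by positivity), eventually_ne_atTop 0,
    hlog2.eventually_lt_const (show 0 < η / 4 by positivity)] with n hn hn0 hn2
  set p := (Measure.pi fun _ : Fin n => P).real {z | empMeasure z ∈ C}
  have hn' : (0 : ℝ) < n := by positivity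
  have hp : 0 < p := lt_of_lt_of_le (by positivity) hn
  obtain ⟨R, hRC, hR⟩ := exists_mem_klDiv_le hprob hconv hclosed hn0 P (hmeas n hn0) hp
  have hupper : I ≤ -(1 / (n : ℝ) * Real.log p) := by
    refine (ENNReal.ofReal_le_ofReal_iff ?_).1 ((hle R hRC).trans hR)
    rw [neg_nonneg]
    exact mul_nonpos_of_nonneg_of_nonpos (by positivity)
      (Real.log_nonpos hp.le measureReal_le_one)
  have hlower : -(∫ x, llr Q P x ∂Q + η / 4) - Real.log 2 / n ≤ 1 / (n : ℝ) * Real.log p := by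
    have := Real.log_le_log (by positivity) hn
    rw [Real.log_div (Real.exp_pos _).ne' two_ne_zero, Real.log_exp] at this
    calc _ = 1 / (n : ℝ) * (-(n * (∫ x, llr Q P x ∂Q + η / 4)) - Real.log 2) := by field_simp
      _ ≤ _ := by gcongr
  rw [Real.dist_eq, abs_lt]
  constructor <;> linarith

/-- If the divergence of `R` is finite, a mixture of `Q` and `R` with small positive weight on `R`
has divergence within `η` of a bound for `Q`. -/
theorem exists_convexComb_klDiv_le {X : Type*} [MeasurableSpace X] {Q R P : Measure X}
    [IsProbabilityMeasure Q] [IsProbabilityMeasure R] [IsProbabilityMeasure P] {a η : ℝ}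
    (ha : 0 ≤ a) (hη : 0 < η) (hQ : klDiv Q P ≤ ENNReal.ofReal a) (hR : klDiv R P ≠ ∞) :
    ∃ lam : ℝ, 0 < lam ∧ lam < 1 ∧
      klDiv (ENNReal.ofReal (1 - lam) • Q + ENNReal.ofReal lam • R) P
        ≤ ENNReal.ofReal (a + η) := by
  set k := (klDiv R P).toReal with hk
  have hk0 : 0 ≤ k := ENNReal.toReal_nonneg
  have hlam : 0 < min (1 / 2) (η / (k + 1)) := by positivity
  have hlam1 : min (1 / 2) (η / (k + 1)) < 1 := (min_le_left _ _).trans_lt (by norm_num)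
  refine ⟨_, hlam, hlam1, (klDiv_convexComb_le Q R P hlam hlam1).trans ?_⟩
  have hlamk : min (1 / 2) (η / (k + 1)) * k ≤ η :=
    calc min (1 / 2) (η / (k + 1)) * k ≤ η / (k + 1) * (k + 1) := by
          gcongr
          · exact min_le_right _ _
          · linarith
      _ = η := by field_simp
  generalize min (1 / 2) (η / (k + 1)) = lam at *
  calc _ ≤ ENNReal.ofReal (1 - lam) * ENNReal.ofReal a + ENNReal.ofReal lam * ENNReal.ofReal k := by
        gcongr
        exact (ENNReal.ofReal_toReal hR).ge
    _ = ENNReal.ofReal ((1 - lam) * a + lam * k) := by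
        rw [← ENNReal.ofReal_mul (by linarith), ← ENNReal.ofReal_mul hlam.le,
          ← ENNReal.ofReal_add (mul_nonneg (by linarith) ha) (by positivity)]
    _ ≤ ENNReal.ofReal (a + η) := by
        refine ENNReal.ofReal_le_ofReal ?_
        nlinarith [mul_nonneg hlam.le ha]

end

/-- Sanov-type asymptotics on a Polish space: for a convex, weak-convergence–continuous
pseudometric `D` with `I_{ε0}(θ) < ∞` and `ε > ε0`,
`(1/n) log Pθ^{⊗n}( D(P̂_z, P0) ≤ ε ) → − I_ε(θ)`. -/
theorem stmt9 {X : Type*} [MeasurableSpace X] [TopologicalSpace X] [PolishSpace X]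
    [BorelSpace X]
    (P0 Pθ : Measure X) [IsProbabilityMeasure P0] [IsProbabilityMeasure Pθ]
    (D : Measure X → Measure X → ℝ)
    (hDnonneg : ∀ P Q : Measure X, IsProbabilityMeasure P → IsProbabilityMeasure Q →
      0 ≤ D P Q)
    (hDrefl : ∀ P : Measure X, IsProbabilityMeasure P → D P P = 0)
    (hDsymm : ∀ P Q : Measure X, IsProbabilityMeasure P → IsProbabilityMeasure Q →
      D P Q = D Q P)
    (hDtri : ∀ P Q R : Measure X, IsProbabilityMeasure P → IsProbabilityMeasure Q →
      IsProbabilityMeasure R → D P Q ≤ D P R + D R Q)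
    (hDconv : ∀ P Q R : Measure X, IsProbabilityMeasure P → IsProbabilityMeasure Q →
      IsProbabilityMeasure R → ∀ lam : ℝ, 0 < lam → lam < 1 →
      D P (ENNReal.ofReal (1 - lam) • Q + ENNReal.ofReal lam • R) ≤
        (1 - lam) * D P Q + lam * D P R)
    (hDcont : ∀ (Ps : ℕ → Measure X) (P Q : Measure X),
      (∀ n, IsProbabilityMeasure (Ps n)) → IsProbabilityMeasure P →
      IsProbabilityMeasure Q →
      (∀ f : X →ᵇ ℝ, Tendsto (fun n => ∫ x, f x ∂(Ps n)) atTop (𝓝 (∫ x, f x ∂P))) →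
      Tendsto (fun n => D (Ps n) Q) atTop (𝓝 (D P Q)))
    (ε0 : ℝ) (hε0 : 0 ≤ ε0) (hI0 : OKLD D P0 Pθ ε0 ≠ ⊤)
    (ε : ℝ) (hε : ε0 < ε) :
    Tendsto (fun n : ℕ => (1 / (n : ℝ)) * Real.log
        (((Measure.pi fun _ : Fin n => Pθ)
          {z : Fin n → X | D (empMeasure z) P0 ≤ ε}).toReal))
      atTop (𝓝 (-(OKLD D P0 Pθ ε).toReal)) := by
  let C (r : ℝ) : Set (Measure X) := {Q | IsProbabilityMeasure Q ∧ D Q P0 ≤ r}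
  have hDmix {Q R : Measure X} (hQ : IsProbabilityMeasure Q) (hR : IsProbabilityMeasure R)
      {lam : ℝ} (h0 : 0 < lam) (h1 : lam < 1) :
      D (ENNReal.ofReal (1 - lam) • Q + ENNReal.ofReal lam • R) P0
        ≤ (1 - lam) * D Q P0 + lam * D R P0 := by
    have := isProbabilityMeasure_convexComb Q R h0 h1
    rw [hDsymm _ _ this inferInstance, hDsymm Q _ hQ inferInstance, hDsymm R _ hR inferInstance]
    exact hDconv P0 Q R inferInstance hQ hR lam h0 h1
  have hIle : OKLD D P0 Pθ ε ≤ OKLD D P0 Pθ ε0 :=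
    biInf_mono fun Q hQ => ⟨hQ.1, hQ.2.trans hε.le⟩
  have hI : ENNReal.ofReal (OKLD D P0 Pθ ε).toReal = OKLD D P0 Pθ ε :=
    ENNReal.ofReal_toReal (hIle.trans_lt hI0.lt_top).ne
  have key := tendsto_log_measure_empMeasure_mem (C := C ε) (fun Q hQ => hQ.1)
    (fun Q hQ R hR lam h0 h1 => ?_) (fun Qs Q hQs hQ hlim => ⟨hQ, ?_⟩) Pθ
    (ENNReal.toReal_nonneg (a := OKLD D P0 Pθ ε)) (fun Q hQ => ?_) (fun η hη => ?_)
  · refine key.congr' ?_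
    filter_upwards [eventually_ne_atTop 0] with n hn
    have : {z : Fin n → X | empMeasure z ∈ C ε} = {z | D (empMeasure z) P0 ≤ ε} :=
      Set.ext fun z => and_iff_right (isProbabilityMeasure_empMeasure hn z)
    rw [this, Measure.real]
  · have := hQ.1
    have := hR.1
    refine ⟨isProbabilityMeasure_convexComb Q R h0 h1, (hDmix hQ.1 hR.1 h0 h1).trans ?_⟩
    nlinarith [hQ.2, hR.2]
  · exact le_of_tendsto' (hDcont Qs Q P0 (fun n => (hQs n).1) hQ inferInstance hlim)
      fun n => (hQs n).2
  · have := hQ.1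
    rw [hI, ← KLdiv_eq_klDiv]
    exact biInf_le _ hQ
  · obtain ⟨Q, hQ, hQI⟩ : ∃ Q ∈ C ε, KLdiv Q Pθ
        < ENNReal.ofReal ((OKLD D P0 Pθ ε).toReal + η / 2) := by
      have hlt : OKLD D P0 Pθ ε < ENNReal.ofReal ((OKLD D P0 Pθ ε).toReal + η / 2) := by
        conv_lhs => rw [← hI]
        exact (ENNReal.ofReal_lt_ofReal_iff (by positivity)).2 (by linarith)
      simpa only [OKLD, iInf_lt_iff, exists_prop] using hlt
    obtain ⟨R, hR, hRI⟩ : ∃ R ∈ C ε0, KLdiv R Pθ < ⊤ := by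
      simpa only [OKLD, iInf_lt_iff, exists_prop] using hI0.lt_top
    have := hQ.1
    have := hR.1
    rw [KLdiv_eq_klDiv] at hQI hRI
    obtain ⟨lam, h0, h1, hkl⟩ := exists_convexComb_klDiv_le (by positivity) (half_pos hη) hQI.le
      hRI.ne
    have hmix := isProbabilityMeasure_convexComb Q R h0 h1
    refine ⟨_, hmix, by rwa [add_assoc, add_halves] at hkl, fun Ps hPs hlim => ?_⟩
    have hlt : D (ENNReal.ofReal (1 - lam) • Q + ENNReal.ofReal lam • R) P0 < ε :=
      (hDmix hQ.1 hR.1 h0 h1).trans_lt (by nlinarith [hQ.2, hR.2])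
    filter_upwards [(hDcont Ps _ P0 hPs hmix inferInstance hlim).eventually_lt_const hlt]
      with n hn
    exact ⟨hPs n, hn.le⟩
end

section
/- Let (X, λ) be a σ-finite measure space, let p0 be a probability density with respect to λ, let ε ≥ 0, and let p_{θ1}, p_{θ2} be probability densities with respect to λ that are strictly positive λ-a.e. Suppose d = esssup_x | log( p_{θ1}(x) / p_{θ2}(x) ) | < ∞. Define, for j = 1, 2, I_ε(θ_j) = inf { ∫ q log(q / p_{θ_j}) dλ : q a probability density with (1/2)∫ |q − p0| dλ ≤ ε }. Then | I_ε(θ1) − I_ε(θ2) | ≤ d, with the convention that the inequality holds in the extended reals. -/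
open MeasureTheory ENNReal
open scoped Classical

/-- `f` is a probability density with respect to `lam`. -/
def IsDensity {X : Type*} [MeasurableSpace X] (lam : Measure X) (f : X → ℝ) : Prop :=
  Measurable f ∧ (∀ x, 0 ≤ f x) ∧ ∫⁻ x, ENNReal.ofReal (f x) ∂lam = 1

/-- Total variation distance between densities: `tv(p, q) = (1/2) ∫ |p − q| dλ`. -/
noncomputable def tvDist {X : Type*} [MeasurableSpace X] (lam : Measure X)
    (p q : X → ℝ) : ℝ≥0∞ :=
  (∫⁻ x, ENNReal.ofReal |p x - q x| ∂lam) / 2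

/-- Kullback–Leibler divergence between densities (convention `0 log 0 = 0`, with the value
`∞` when not absolutely continuous or not integrable). -/
noncomputable def KLd {X : Type*} [MeasurableSpace X] (lam : Measure X)
    (p q : X → ℝ) : ℝ≥0∞ :=
  if (∀ᵐ x ∂lam, q x = 0 → p x = 0) ∧
      Integrable (fun x => p x * Real.log (p x / q x)) lam
  then ENNReal.ofReal (∫ x, p x * Real.log (p x / q x) ∂lam) else ⊤

/-- The OKL function for densities: `I_ε(θ) = inf { KL(q|pθ) : q a density, tv(q,p0) ≤ ε }`. -/
noncomputable def OKLdens {X : Type*} [MeasurableSpace X] (lam : Measure X)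
    (p0 pθ : X → ℝ) (ε : ℝ) : ℝ≥0∞ :=
  ⨅ q ∈ {q : X → ℝ | IsDensity lam q ∧ tvDist lam q p0 ≤ ENNReal.ofReal ε},
    KLd lam q pθ

lemma IsDensity.integrable {X : Type*} [MeasurableSpace X] {lam : Measure X} {f : X → ℝ}
    (hf : IsDensity lam f) : Integrable f lam :=
  (lintegral_ofReal_ne_top_iff_integrable hf.1.aestronglyMeasurable
    (ae_of_all _ hf.2.1)).mp (by simp [hf.2.2])

lemma IsDensity.integral_eq_one {X : Type*} [MeasurableSpace X] {lam : Measure X} {f : X → ℝ}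
    (hf : IsDensity lam f) : ∫ x, f x ∂lam = 1 := by
  rw [integral_eq_lintegral_of_nonneg_ae (ae_of_all _ hf.2.1) hf.1.aestronglyMeasurable, hf.2.2,
    ENNReal.toReal_one]

/-- Changing the reference density changes the divergence by at most the sup-log distance. -/
lemma KLd_le_KLd_add {X : Type*} [MeasurableSpace X] {lam : Measure X} {q p r : X → ℝ}
    (hq : IsDensity lam q) (hp : Measurable p) (hr : Measurable r)
    (hp_pos : ∀ᵐ x ∂lam, 0 < p x) (hr_pos : ∀ᵐ x ∂lam, 0 < r x) {d : ℝ}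
    (hd : ∀ᵐ x ∂lam, |Real.log (p x / r x)| ≤ d) :
    KLd lam q p ≤ KLd lam q r + ENNReal.ofReal d := by
  by_cases hqr : (∀ᵐ x ∂lam, r x = 0 → q x = 0) ∧
      Integrable (fun x => q x * Real.log (q x / r x)) lam
  swap
  · simp [KLd, if_neg hqr]
  have h_eq : (fun x => q x * Real.log (q x / r x) - q x * Real.log (p x / r x))
      =ᵐ[lam] fun x => q x * Real.log (q x / p x) := by
    filter_upwards [hp_pos, hr_pos] with x hpx hrx
    rcases eq_or_ne (q x) 0 with h | h
    · simp [h]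
    · rw [Real.log_div h hrx.ne', Real.log_div hpx.ne' hrx.ne', Real.log_div h hpx.ne']
      ring
  have h_log : Integrable (fun x => q x * Real.log (p x / r x)) lam :=
    hq.integrable.mul_bdd (hp.div hr).log.aestronglyMeasurable hd
  have h_int := (hqr.2.sub h_log).congr h_eq
  have h_le : ∫ x, q x * Real.log (q x / p x) ∂lam
      ≤ ∫ x, q x * Real.log (q x / r x) ∂lam + d := by
    have h_lower : ∫ x, q x * -d ∂lam ≤ ∫ x, q x * Real.log (p x / r x) ∂lam := by
      refine integral_mono_ae (hq.integrable.mul_const _) h_log ?_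
      filter_upwards [hd] with x hx
      exact mul_le_mul_of_nonneg_left (abs_le.mp hx).1 (hq.2.1 x)
    rw [integral_mul_const, hq.integral_eq_one] at h_lower
    rw [← integral_congr_ae h_eq, integral_sub hqr.2 h_log]
    linarith
  have hqp : ∀ᵐ x ∂lam, p x = 0 → q x = 0 := by
    filter_upwards [hp_pos] with x hx h using absurd h hx.ne'
  rw [KLd, KLd, if_pos ⟨hqp, h_int⟩, if_pos hqr]
  exact (ENNReal.ofReal_le_ofReal h_le).trans ENNReal.ofReal_add_le

lemma OKLdens_le_OKLdens_add {X : Type*} [MeasurableSpace X] {lam : Measure X}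
    (p0 : X → ℝ) (ε : ℝ) {p r : X → ℝ} (hp : Measurable p) (hr : Measurable r)
    (hp_pos : ∀ᵐ x ∂lam, 0 < p x) (hr_pos : ∀ᵐ x ∂lam, 0 < r x) {d : ℝ}
    (hd : ∀ᵐ x ∂lam, |Real.log (p x / r x)| ≤ d) :
    OKLdens lam p0 p ε ≤ OKLdens lam p0 r ε + ENNReal.ofReal d := by
  simp only [OKLdens, ENNReal.iInf_add]
  exact le_iInf₂ fun q hq =>
    (iInf₂_le q hq).trans (KLd_le_KLd_add hq.1 hp hr hp_pos hr_pos hd)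

/-- The OKL function is Lipschitz in the sup-log distance between model densities:
if `|log(pθ1/pθ2)| ≤ d` λ-a.e. then `|I_ε(θ1) − I_ε(θ2)| ≤ d` in the extended reals. -/
theorem stmt12 {X : Type*} [MeasurableSpace X] (lam : Measure X) [SigmaFinite lam]
    (p0 : X → ℝ) (h0 : IsDensity lam p0) (ε : ℝ) (hε : 0 ≤ ε)
    (pθ1 pθ2 : X → ℝ) (h1 : IsDensity lam pθ1) (h2 : IsDensity lam pθ2)
    (h1pos : ∀ᵐ x ∂lam, 0 < pθ1 x) (h2pos : ∀ᵐ x ∂lam, 0 < pθ2 x)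
    (d : ℝ) (hd : ∀ᵐ x ∂lam, |Real.log (pθ1 x / pθ2 x)| ≤ d) :
    OKLdens lam p0 pθ1 ε ≤ OKLdens lam p0 pθ2 ε + ENNReal.ofReal d ∧
    OKLdens lam p0 pθ2 ε ≤ OKLdens lam p0 pθ1 ε + ENNReal.ofReal d := by
  refine ⟨OKLdens_le_OKLdens_add p0 ε h1.1 h2.1 h1pos h2pos hd,
    OKLdens_le_OKLdens_add p0 ε h2.1 h1.1 h2pos h1pos ?_⟩
  filter_upwards [hd] with x hx
  rwa [← inv_div, Real.log_inv, abs_neg]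
end
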